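/- arXiv:2603.13241 — 2 statements merged into one kernel-verified Lean document; each statement's English description precedes it below -/
import Mathlib

section
/- For every real α with α > 0 and α ≠ 1, every natural number K ≥ 1, and every probability vector p on K classes, T_α(p) ≤ (1 - K^(1-α))/(α - 1), and this upper bound is attained at the uniform distribution p i = 1/K for all i. -/
/-- Tsallis entropy of a probability vector `p` with parameter `α`. -/
noncomputable def tsallis (α : ℝ) {K : ℕ} (p : Fin K → ℝ) : ℝ :=
  (1 - ∑ i, p i ^ α) / (α - 1)

/-- Maximal value of the Tsallis entropy on the simplex of `K` classes. -/
noncomputable def tsallisMax (α : ℝ) (K : ℕ) : ℝ :=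
  (1 - (K : ℝ) ^ (1 - α)) / (α - 1)

/-- Tsallis entropy is bounded above by `(1 - K^(1-α))/(α-1)`, and this bound is
attained at the uniform distribution. -/
theorem tsallis_le_max_and_uniform_attains (α : ℝ) (hα : 0 < α) (hα1 : α ≠ 1)
    (K : ℕ) (hK : 1 ≤ K)
    (p : Fin K → ℝ) (hp : ∀ i, 0 ≤ p i) (hp1 : ∑ i, p i = 1) :
    tsallis α p ≤ tsallisMax α K ∧
      tsallis α (fun _ : Fin K => 1 / (K : ℝ)) = tsallisMax α K := by
  have hK0 : (0 : ℝ) < K := by exact_mod_cast hK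
  have hU : (K : ℝ) ^ (1 - α) = K * (1 / (K : ℝ)) ^ α := by
    rw [Real.rpow_sub hK0, Real.rpow_one, Real.div_rpow zero_le_one hK0.le, Real.one_rpow]
    ring
  have hw : ∑ _i : Fin K, (1 / (K : ℝ)) = 1 := by
    simp [hK0.ne']
  have hw0 : ∀ i ∈ (Finset.univ : Finset (Fin K)), (0 : ℝ) ≤ 1 / (K : ℝ) :=
    fun _ _ => by positivity
  have hmem : ∀ i ∈ (Finset.univ : Finset (Fin K)), p i ∈ Set.Ici (0 : ℝ) := fun i _ => hp i
  have hS : ∀ x : ℝ, (K : ℝ) * (1 / (K : ℝ) * x) = x := fun x => by field_simp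
  refine ⟨?_, ?_⟩
  · unfold tsallis tsallisMax
    rw [hU]
    rcases lt_or_gt_of_ne hα1 with h | h
    · have hJ := (Real.concaveOn_rpow hα.le h.le).le_map_sum hw0 hw hmem
      simp only [smul_eq_mul, ← Finset.mul_sum, hp1, mul_one] at hJ
      have h2 := mul_le_mul_of_nonneg_left hJ hK0.le
      rw [hS] at h2
      exact div_le_div_of_nonpos_of_le (by linarith) (by linarith)
    · have hJ := (convexOn_rpow h.le).map_sum_le hw0 hw hmem
      simp only [smul_eq_mul, ← Finset.mul_sum, hp1, mul_one] at hJ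
      have h2 := mul_le_mul_of_nonneg_left hJ hK0.le
      rw [hS] at h2
      exact div_le_div_of_nonneg_right (by linarith) (by linarith)
  · unfold tsallis tsallisMax
    rw [hU]
    simp
end

section
/- For every real α with α > 0 and α ≠ 1, every natural number K ≥ 2, and every probability vector p on K classes, equality T_α(p) = (1 - K^(1-α))/(α - 1) holds if and only if p is the uniform distribution, i.e., p i = 1/K for all i. -/
/-- Tsallis entropy attains its maximal value exactly at the uniform distribution. -/
theorem tsallis_eq_max_iff_uniform (α : ℝ) (hα : 0 < α) (hα1 : α ≠ 1)
    (K : ℕ) (hK : 2 ≤ K)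
    (p : Fin K → ℝ) (hp : ∀ i, 0 ≤ p i) (hp1 : ∑ i, p i = 1) :
    tsallis α p = tsallisMax α K ↔ ∀ i, p i = 1 / (K : ℝ) := by
  have hK0 : (0 : ℝ) < K := by
    have : 0 < K := by omega
    exact_mod_cast this
  have hw0 : ∀ i ∈ (Finset.univ : Finset (Fin K)), (0 : ℝ) < (fun _ : Fin K => 1 / (K : ℝ)) i :=
    fun i _ => by positivity
  have hw1 : ∑ i : Fin K, (fun _ : Fin K => 1 / (K : ℝ)) i = 1 := by
    simp [hK0.ne']
  have hmem : ∀ i ∈ (Finset.univ : Finset (Fin K)), p i ∈ Set.Ici (0 : ℝ) := fun i _ => hp i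
  have key : (∑ i : Fin K, (fun _ : Fin K => 1 / (K : ℝ)) i • p i) ^ α
      = ∑ i : Fin K, (fun _ : Fin K => 1 / (K : ℝ)) i • p i ^ α ↔
      ∀ j ∈ (Finset.univ : Finset (Fin K)),
        p j = ∑ i : Fin K, (fun _ : Fin K => 1 / (K : ℝ)) i • p i := by
    rcases lt_or_gt_of_ne hα1 with h | h
    · exact (Real.strictConcaveOn_rpow hα h).map_sum_eq_iff hw0 hw1 hmem
    · exact (strictConvexOn_rpow h).map_sum_eq_iff hw0 hw1 hmem
  simp only [smul_eq_mul, ← Finset.mul_sum, hp1, mul_one, Finset.mem_univ, true_imp_iff] at key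
  rw [← key]
  have hpow : (K : ℝ) ^ (1 - α) = K * (1 / (K : ℝ)) ^ α := by
    rw [Real.rpow_sub hK0, Real.rpow_one, Real.div_rpow zero_le_one hK0.le, Real.one_rpow]
    ring
  unfold tsallis tsallisMax
  rw [div_left_inj' (sub_ne_zero.mpr hα1), sub_right_inj, hpow]
  constructor
  · intro h
    rw [h]
    field_simp
  · intro h
    rw [h]
    field_simp
end
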